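/- Suppose the triple (m, N, a) satisfies condition (⋆). Then (m, N, a) is equivalent to one of the following twenty triples: (2, 4, (1,1,1,1)); (2, 6, (1,1,1,1,1,1)); (3, 4, (1,1,2,2)); (4, 4, (1,2,2,3)); (6, 4, (2,3,3,4)); (3, 5, (1,1,1,1,2)); (4, 4, (1,1,1,1)); (4, 5, (1,1,2,2,2)); (6, 4, (1,3,4,4)); (3, 6, (1,1,1,1,1,1)); (5, 4, (1,3,3,3)); (6, 4, (1,1,1,3)); (6, 4, (1,1,2,2)); (6, 5, (2,2,2,3,3)); (8, 4, (2,4,5,5)); (5, 5, (2,2,2,2,2)); (7, 4, (2,4,4,4)); (10, 4, (3,5,6,6)); (9, 4, (3,5,5,5)); (12, 4, (4,6,7,7)). -/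

import Mathlib

open Finset

/-- The dimension `d_n` of the Hodge eigenspace: `d_n = (1/m)·∑_i ((n·a_i) mod m) − 1`,
where `(x mod m)` is the representative of `x` in `{0, …, m−1}` (here `Int.emod`,
which lands in `{0, …, m−1}` since `m > 0`). -/
def hodgeDim (m N : ℕ) (a : Fin N → ℤ) (n : ℤ) : ℚ :=
  ((∑ i, (n * a i) % (m : ℤ) :) : ℚ) / m - 1

/-- The hypotheses on a triple `(m, N, a)`: `m ≥ 2`, `N ≥ 4`, `1 ≤ a_i ≤ m − 1` for all `i`,
`gcd(m, a_1, …, a_N) = 1`, and `a_1 + ⋯ + a_N ≡ 0 (mod m)`. -/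
def IsTriple (m N : ℕ) (a : Fin N → ℤ) : Prop :=
  2 ≤ m ∧ 4 ≤ N ∧ (∀ i, 1 ≤ a i ∧ a i ≤ (m : ℤ) - 1) ∧
    Int.gcd (m : ℤ) (Finset.univ.gcd a) = 1 ∧ ((m : ℤ) ∣ ∑ i, a i)

/-- Condition (⋆): `N − 3 = ∑_{n=1}^{⌊(m−1)/2⌋} d_n·d_{m−n} + ε`, where
`ε = d_{m/2}(d_{m/2}+1)/2` if `m` is even and `ε = 0` if `m` is odd. -/
def CondStar (m N : ℕ) (a : Fin N → ℤ) : Prop :=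
  (N : ℚ) - 3 =
    (∑ n ∈ Finset.Icc 1 ((m - 1) / 2), hodgeDim m N a n * hodgeDim m N a ((m : ℤ) - n)) +
      if m % 2 = 0 then hodgeDim m N a (m / 2) * (hodgeDim m N a (m / 2) + 1) / 2 else 0

/-- Two `N`-tuples are equivalent (for the modulus `m`) if there is `t` with `gcd(t, m) = 1`
and a permutation `σ` with `a'_i ≡ t·a_{σ(i)} (mod m)` for all `i`. -/
def EquivTuple (m N : ℕ) (a a' : Fin N → ℤ) : Prop :=
  ∃ t : ℤ, Int.gcd t m = 1 ∧ ∃ σ : Equiv.Perm (Fin N),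
    ∀ i, a' i ≡ t * a (σ i) [ZMOD (m : ℤ)]

/-- The twenty triples, each given as the pair of `m` and the tuple `a`
(the number of branch points `N` being the length of the tuple). -/
def twentyTriples : List (ℕ × List ℕ) :=
  [(2, [1,1,1,1]), (2, [1,1,1,1,1,1]), (3, [1,1,2,2]), (4, [1,2,2,3]),
   (6, [2,3,3,4]), (3, [1,1,1,1,2]), (4, [1,1,1,1]), (4, [1,1,2,2,2]),
   (6, [1,3,4,4]), (3, [1,1,1,1,1,1]), (5, [1,3,3,3]), (6, [1,1,1,3]),
   (6, [1,1,2,2]), (6, [2,2,2,3,3]), (8, [2,4,5,5]), (5, [2,2,2,2,2]),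
   (7, [2,4,4,4]), (10, [3,5,6,6]), (9, [3,5,5,5]), (12, [4,6,7,7])]

/-- `IsBalanced m a b c e j` says that none of `j·a, j·b, j·c, j·e` is divisible by `m` and that
their four quotients by `m` add up to `j - 2`; when `a + b + c + e = m`, this means that the four
residues add up to `2m`. -/
def IsBalanced (m a b c e j : ℕ) : Prop :=
  ∃ f g h i : ℕ, (f * m < j * a ∧ j * a < (f + 1) * m) ∧ (g * m < j * b ∧ j * b < (g + 1) * m) ∧
    (h * m < j * c ∧ j * c < (h + 1) * m) ∧ (i * m < j * e ∧ j * e < (i + 1) * m) ∧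
    f + g + h + i + 2 = j

/-- If a multiple `n·m` of `m` lies strictly between `j·b` and `j·(b+c+e)`, and `j·(c+e) ≤ m`,
then `j` is balanced. -/
lemma isBalanced_of_window {m a b c e n j : ℕ} (hsum : a + b + c + e = m) (ha : 0 < a) (hc : 0 < c)
    (he : 0 < e) (h1 : j * b < n * m) (h2 : n * m < j * (b + c + e)) (h3 : j * (c + e) ≤ m) :
    IsBalanced m a b c e j := by
  have hm : 0 < m := by omega
  have hn : 0 < n := Nat.pos_of_ne_zero (by rintro rfl; simp at h1)
  have hnj : n < j := by
    by_contra! hcon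
    have := Nat.mul_le_mul hcon (show b + c + e ≤ m by omega)
    omega
  obtain ⟨g, rfl⟩ : ∃ g, n = g + 1 := ⟨n - 1, by omega⟩
  obtain ⟨f, rfl⟩ : ∃ f, j = f + g + 2 := ⟨j - g - 2, by omega⟩
  have hj : (f + g + 2) * a + (f + g + 2) * b + (f + g + 2) * c + (f + g + 2) * e
      = (f + g + 2) * m := by rw [← hsum]; ring
  have hjc : 0 < (f + g + 2) * c := by positivity
  have hje : 0 < (f + g + 2) * e := by positivity
  refine ⟨f, g, 0, 0, ⟨?_, ?_⟩, ⟨?_, ?_⟩, ⟨?_, ?_⟩, ⟨?_, ?_⟩, by omega⟩ <;> nlinarith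

/-- Near the end of the range `j·(c+e) ≤ m`, one of two consecutive integers is balanced. -/
lemma isBalanced_or_pred {m a b c e j : ℕ} (hsum : a + b + c + e = m) (ha : 0 < a)
    (hc : 0 < c) (he : 0 < e) (h1 : (j + 1) * (c + e) ≤ m) (h2 : a < j * (c + e))
    (h3 : m < (j + 1) * (c + e) + a) :
    IsBalanced m a b c e (j + 1) ∨ IsBalanced m a b c e j := by
  have hm : 0 < m := by omega
  obtain ⟨q, r, hqr, hrm⟩ : ∃ q r, q * m + r = (j + 1) * a ∧ r < m :=
    ⟨(j + 1) * a / m, (j + 1) * a % m, Nat.div_add_mod' _ _, Nat.mod_lt _ hm⟩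
  have hj : (j + 1) * a + (j + 1) * b + (j + 1) * (c + e) = (j + 1) * m := by rw [← hsum]; ring
  have hqj : q ≤ j := by
    by_contra! hcon
    have := Nat.mul_le_mul_right m hcon
    nlinarith
  obtain ⟨n, hn⟩ : ∃ n, j = q + n := ⟨j - q, by omega⟩
  rcases lt_or_ge m (r + (j + 1) * (c + e)) with h | h
  · left
    refine isBalanced_of_window (n := n) hsum ha hc he ?_ ?_ h1
    · subst hn; nlinarith
    · have : (j + 1) * (b + c + e) = (j + 1) * b + (j + 1) * (c + e) := by ring
      subst hn; nlinarith
  · right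
    refine isBalanced_of_window (n := n) hsum ha hc he ?_ ?_ (by nlinarith)
    · subst hn; nlinarith
    · have : (j + 1) * (b + c + e) = (j + 1) * b + (j + 1) * (c + e) := by ring
      subst hn; nlinarith

lemma isBalanced_two {m a b c e : ℕ} (hab : b ≤ a) (hbc : c ≤ b) (hce : e ≤ c) (he : 0 < e)
    (h : 2 * a < m) : IsBalanced m a b c e 2 :=
  ⟨0, 0, 0, 0, by omega, by omega, by omega, by omega, rfl⟩

/-- If `m < j·(b+c+e) < 2m` and `b` is less than half of `b+c+e`, then `j` is balanced. -/
lemma isBalanced_of_lt_two_mul {m a b c e j : ℕ} (hsum : a + b + c + e = m) (hbc : c ≤ b)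
    (hce : e ≤ c) (he : 0 < e) (hb : b < c + e) (h1 : m < j * (b + c + e))
    (h2 : j * (b + c + e) < 2 * m) : IsBalanced m a b c e j := by
  have hm : 0 < m := by omega
  have hj : 2 ≤ j := by
    by_contra! hcon
    have : j * (b + c + e) ≤ 1 * (b + c + e) := Nat.mul_le_mul_right _ (by omega)
    omega
  obtain ⟨f, rfl⟩ : ∃ f, j = f + 2 := ⟨j - 2, by omega⟩
  have hs : (f + 2) * a + (f + 2) * (b + c + e) = (f + 2) * m := by rw [← hsum]; ring
  have h3 : (f + 2) * b < m := by nlinarith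
  have h4 : (f + 2) * c ≤ (f + 2) * b := Nat.mul_le_mul_left _ hbc
  have h5 : (f + 2) * e ≤ (f + 2) * c := Nat.mul_le_mul_left _ hce
  have h6 : 0 < (f + 2) * e := by positivity
  refine ⟨f, 0, 0, 0, ⟨?_, ?_⟩, ⟨?_, ?_⟩, ⟨?_, ?_⟩, ⟨?_, ?_⟩, by omega⟩ <;> nlinarith

lemma exists_floor_div (m t : ℕ) (ht : 0 < t) (h : t ≤ m) :
    ∃ k, 0 < k ∧ k * t ≤ m ∧ m < (k + 1) * t :=
  ⟨m / t, Nat.div_pos h ht, Nat.div_mul_le_self m t, by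
    rw [Nat.add_mul, Nat.one_mul]; exact Nat.lt_div_mul_add ht⟩

lemma exists_isBalanced {m a b c e : ℕ} (hsum : a + b + c + e = m) (hab : b ≤ a) (hbc : c ≤ b)
    (hce : e ≤ c) (he : 0 < e) : ∃ j, j < m ∧ IsBalanced m a b c e j := by
  rcases lt_or_ge (2 * a) m with h | h
  · exact ⟨2, by omega, isBalanced_two hab hbc hce he h⟩
  rcases lt_or_ge b (c + e) with hb | hb
  · obtain ⟨k, hk0, hk1, hk2⟩ := exists_floor_div m (b + c + e) (by omega) (by omega)
    exact ⟨k + 1, by nlinarith, isBalanced_of_lt_two_mul hsum hbc hce he hb hk2 (by nlinarith)⟩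
  · obtain ⟨k, hk0, hk1, hk2⟩ := exists_floor_div m (c + e) (by omega) (by omega)
    obtain ⟨j, rfl⟩ : ∃ j, k = j + 1 := ⟨k - 1, by omega⟩
    rcases isBalanced_or_pred hsum (by omega) (by omega) he hk1 (by nlinarith) (by nlinarith)
      with h' | h'
    · exact ⟨j + 1, by nlinarith, h'⟩
    · exact ⟨j, by nlinarith, h'⟩

/-- Checks that `j·y` stays strictly between two consecutive integers for all real `y > 0` with
`p ≤ K·y < p + 1`. -/
def boxFits (K j p : ℕ) : Bool :=
  Nat.ble (j * p % K + j) K && (p.beq 0 || Nat.blt 0 (j * p % K))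

/-- Checks that `j` is balanced for all `m a b c e` such that the floors of `K·a/m`, `K·b/m`,
`K·c/m`, `K·e/m` are the given numbers. -/
def boxBalanced (K a b c e j : ℕ) : Bool :=
  (j * a / K + j * b / K + j * c / K + j * e / K + 2).beq j &&
  boxFits K j a && boxFits K j b && boxFits K j c && boxFits K j e

/-- Some `i ≤ j` passes `boxBalanced`. -/
def boxSome (K a b c e : ℕ) : ℕ → Bool
  | 0 => false
  | j + 1 => boxBalanced K a b c e (j + 1) || boxSome K a b c e j

/-- Two different `i ≤ j` pass `boxBalanced`. -/
def boxTwo (K a b c e : ℕ) : ℕ → Bool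
  | 0 => false
  | j + 1 =>
    bif boxBalanced K a b c e (j + 1) then boxSome K a b c e j else boxTwo K a b c e j

/-- All boxes in the region `R` pass `boxTwo` with bound `13`. -/
def boxAll (K : ℕ) (R : ℕ → ℕ → ℕ → ℕ → Bool) : Bool :=
  (List.range (K / 4 + 1)).all fun e => (List.range ((K - 4 * e) / 3 + 1)).all fun c' =>
    (List.range ((K - 4 * e - 3 * c') / 2 + 1)).all fun b' => (List.range 4).all fun d =>
      let c := e + c'
      let b := c + b'
      let a := K - d - b - c - e
      !(R a b c e) || boxTwo K a b c e 13

lemma lt_and_lt_of_boxFits {m K j p x : ℕ} (hj : 0 < j) (hK : 0 < K) (hm : 0 < m) (hx : 0 < x)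
    (h1 : p * m ≤ K * x) (h2 : K * x < (p + 1) * m) (h : boxFits K j p = true) :
    j * p / K * m < j * x ∧ j * x < (j * p / K + 1) * m := by
  simp only [boxFits, Bool.and_eq_true, Bool.or_eq_true, Nat.ble_eq, Nat.beq_eq, Nat.blt] at h
  obtain ⟨h3, h4⟩ := h
  have hdiv := Nat.div_add_mod (j * p) K
  generalize j * p / K = f at *
  generalize j * p % K = r at *
  constructor
  · rcases h4 with rfl | h4
    · have : f = 0 := by
        by_contra h0
        have : 0 < K * f := by positivity
        omega
      subst this
      simp only [zero_mul]
      positivity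
    · apply lt_of_mul_lt_mul_left _ (Nat.zero_le K)
      have h5 : j * (p * m) ≤ j * (K * x) := Nat.mul_le_mul_left _ h1
      have h6 : 0 < r * m := by
        have : 0 < r := h4
        positivity
      calc K * (f * m) < (K * f + r) * m := by linarith
        _ = j * (p * m) := by rw [hdiv, mul_assoc]
        _ ≤ K * (j * x) := by linarith
  · apply lt_of_mul_lt_mul_left _ (Nat.zero_le K)
    have h5 : j * (K * x) < j * ((p + 1) * m) := Nat.mul_lt_mul_of_pos_left h2 hj
    have h6 : (r + j) * m ≤ K * m := Nat.mul_le_mul_right _ h3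
    calc K * (j * x) < j * ((p + 1) * m) := by linarith
      _ = (K * f + r + j) * m := by rw [hdiv]; ring
      _ ≤ K * ((f + 1) * m) := by linarith

lemma exists_boxBalanced_of_boxSome {K a b c e n : ℕ} (h : boxSome K a b c e n = true) :
    ∃ j ≤ n, boxBalanced K a b c e j = true := by
  induction n with
  | zero => simp [boxSome] at h
  | succ n ih =>
    rw [boxSome, Bool.or_eq_true] at h
    rcases h with h | h
    · exact ⟨n + 1, le_rfl, h⟩
    · obtain ⟨j, hj, hb⟩ := ih h
      exact ⟨j, by omega, hb⟩

lemma exists_boxBalanced_of_boxTwo {K a b c e n : ℕ} (h : boxTwo K a b c e n = true) :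
    ∃ i j, i < j ∧ j ≤ n ∧ boxBalanced K a b c e i = true ∧ boxBalanced K a b c e j = true := by
  induction n with
  | zero => simp [boxTwo] at h
  | succ n ih =>
    rw [boxTwo, cond_eq_ite] at h
    split_ifs at h with hb
    · obtain ⟨i, hi, hi'⟩ := exists_boxBalanced_of_boxSome h
      exact ⟨i, n + 1, by omega, le_rfl, hi', hb⟩
    · obtain ⟨i, j, hij, hj, h⟩ := ih h
      exact ⟨i, j, hij, by omega, h⟩

/-- The existence of two balanced integers with sum less than `m`. -/
def HasTwoBalanced (m a b c e : ℕ) : Prop :=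
  ∃ i j, i < j ∧ i + j < m ∧ IsBalanced m a b c e i ∧ IsBalanced m a b c e j

lemma hasTwoBalanced_of_boxAll {m a b c e K : ℕ} {R : ℕ → ℕ → ℕ → ℕ → Bool} (hK : 0 < K)
    (hall : boxAll K R = true) (hm : 26 ≤ m) (hsum : a + b + c + e = m) (hab : b ≤ a)
    (hbc : c ≤ b) (hce : e ≤ c) (he : 0 < e)
    (hR : ∀ p q r s, p * m ≤ K * a → K * a < (p + 1) * m → q * m ≤ K * b → K * b < (q + 1) * m →
      r * m ≤ K * c → K * c < (r + 1) * m → s * m ≤ K * e → K * e < (s + 1) * m →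
      R p q r s = true) :
    HasTwoBalanced m a b c e := by
  have hm0 : 0 < m := by omega
  have key : ∀ x, K * x / m * m ≤ K * x ∧ K * x < (K * x / m + 1) * m := fun x =>
    ⟨Nat.div_mul_le_self _ _, by
      rw [Nat.add_mul, Nat.one_mul]; exact Nat.lt_div_mul_add hm0⟩
  have hmono : ∀ x y, x ≤ y → K * x / m ≤ K * y / m := fun x y h =>
    Nat.div_le_div_right (Nat.mul_le_mul_left _ h)
  have hKm : K * a + K * b + K * c + K * e = K * m := by rw [← hsum]; ring
  obtain ⟨a1, a2⟩ := key a
  obtain ⟨b1, b2⟩ := key b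
  obtain ⟨c1, c2⟩ := key c
  obtain ⟨e1, e2⟩ := key e
  have hba := hmono _ _ hab
  have hcb := hmono _ _ hbc
  have hec := hmono _ _ hce
  have hRR := hR _ _ _ _ a1 a2 b1 b2 c1 c2 e1 e2
  generalize K * a / m = p at *
  generalize K * b / m = q at *
  generalize K * c / m = r at *
  generalize K * e / m = s at *
  have hs1 : p + q + r + s ≤ K := by
    apply le_of_mul_le_mul_right _ hm0
    linarith
  have hs2 : K < p + q + r + s + 4 := by
    apply lt_of_mul_lt_mul_right _ (Nat.zero_le m)
    linarith
  simp only [boxAll, List.all_eq_true, List.mem_range] at hall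
  have hbox := hall s (by omega) (r - s) (by omega) (q - r) (by omega) (K - (p + q + r + s))
    (by omega)
  rw [show s + (r - s) = r by omega, show r + (q - r) = q by omega,
    show K - (K - (p + q + r + s)) - q - r - s = p by omega, hRR] at hbox
  obtain ⟨i, j, hij, hj, hi1, hj1⟩ := exists_boxBalanced_of_boxTwo (by simpa using hbox)
  have hbal : ∀ j, boxBalanced K p q r s j = true → IsBalanced m a b c e j := by
    intro j h
    simp only [boxBalanced, Bool.and_eq_true, Nat.beq_eq] at h
    obtain ⟨⟨⟨⟨h1, h2⟩, h3⟩, h4⟩, h5⟩ := h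
    have hj : 0 < j := lt_of_lt_of_eq (Nat.succ_pos _) h1
    exact ⟨_, _, _, _, lt_and_lt_of_boxFits hj hK hm0 (by omega) a1 a2 h2,
      lt_and_lt_of_boxFits hj hK hm0 (by omega) b1 b2 h3,
      lt_and_lt_of_boxFits hj hK hm0 (by omega) c1 c2 h4,
      lt_and_lt_of_boxFits hj hK hm0 he e1 e2 h5, h1⟩
  exact ⟨i, j, hij, by omega, hbal i hi1, hbal j hj1⟩

/-- Boxes meeting the region where the two smallest parts sum to at least `m / 4` and the largest
part is at most `m / 2`. -/
def bulkRegion (p _q r s : ℕ) : Bool :=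
  Nat.ble (2 * p) 60 && Nat.blt 60 (4 * (r + s + 2))

/-- Boxes meeting the region where `c + e ≤ b < 3(c+e)`, `m ≤ 2a` and `m < 4(b+c+e)`. -/
def wedgeRegion (p q r s : ℕ) : Bool :=
  Nat.ble (r + s) q && Nat.blt 100 (2 * p + 2) && Nat.blt 100 (4 * (q + r + s + 3)) &&
    Nat.blt q (3 * (r + s + 2))

set_option maxRecDepth 100000 in
lemma boxAll_bulkRegion : boxAll 60 bulkRegion = true := by decide +kernel

set_option maxRecDepth 100000 in
lemma boxAll_wedgeRegion : boxAll 100 wedgeRegion = true := by decide +kernel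

lemma hasTwoBalanced_of_bulk {m a b c e : ℕ} (hm : 26 ≤ m) (hsum : a + b + c + e = m)
    (hab : b ≤ a) (hbc : c ≤ b) (hce : e ≤ c) (he : 0 < e) (h1 : 2 * a ≤ m)
    (h2 : m ≤ 4 * (c + e)) : HasTwoBalanced m a b c e := by
  refine hasTwoBalanced_of_boxAll (by norm_num) boxAll_bulkRegion hm hsum hab hbc hce he ?_
  intro p q r s a1 a2 b1 b2 c1 c2 e1 e2
  simp only [bulkRegion, Bool.and_eq_true, Nat.blt, Nat.ble_eq, Nat.succ_le_iff]
  constructor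
  · apply le_of_mul_le_mul_right _ (show 0 < m by omega)
    linarith
  · apply lt_of_mul_lt_mul_right _ (Nat.zero_le m)
    linarith

lemma hasTwoBalanced_of_wedge {m a b c e : ℕ} (hm : 26 ≤ m) (hsum : a + b + c + e = m)
    (hab : b ≤ a) (hbc : c ≤ b) (hce : e ≤ c) (he : 0 < e) (h1 : m ≤ 2 * a) (h2 : c + e ≤ b)
    (h3 : b < 3 * (c + e)) (h4 : m < 4 * (b + c + e)) : HasTwoBalanced m a b c e := by
  refine hasTwoBalanced_of_boxAll (by norm_num) boxAll_wedgeRegion hm hsum hab hbc hce he ?_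
  intro p q r s a1 a2 b1 b2 c1 c2 e1 e2
  simp only [wedgeRegion, Bool.and_eq_true, Nat.blt, Nat.ble_eq, Nat.succ_le_iff]
  refine ⟨⟨⟨?_, ?_⟩, ?_⟩, ?_⟩
  · rw [← Nat.lt_succ_iff]
    apply lt_of_mul_lt_mul_right _ (Nat.zero_le m)
    rw [Nat.succ_eq_add_one]
    linarith
  all_goals
    apply lt_of_mul_lt_mul_right _ (Nat.zero_le m)
    linarith

/-- A boolean form of `IsBalanced`. -/
def balancedCheck (m a b c e j : ℕ) : Bool :=
  (j * a / m + j * b / m + j * c / m + j * e / m + 2).beq j &&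
  Nat.blt 0 (j * a % m) && Nat.blt 0 (j * b % m) && Nat.blt 0 (j * c % m) && Nat.blt 0 (j * e % m)

lemma isBalanced_of_balancedCheck {m a b c e j : ℕ} (hm : 0 < m)
    (h : balancedCheck m a b c e j = true) : IsBalanced m a b c e j := by
  simp only [balancedCheck, Bool.and_eq_true, Nat.beq_eq, Nat.blt, Nat.ble_eq] at h
  obtain ⟨⟨⟨⟨h1, h2⟩, h3⟩, h4⟩, h5⟩ := h
  have key : ∀ x, 1 ≤ x % m → x / m * m < x ∧ x < (x / m + 1) * m := fun x hx => by
    have h6 := Nat.div_add_mod' x m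
    have h7 := Nat.mod_lt x hm
    constructor <;> linarith
  exact ⟨_, _, _, _, key _ h2, key _ h3, key _ h4, key _ h5, h1⟩

lemma balancedCheck_small :
    ((List.range' 13 13).all fun m => (List.range (m / 4 + 1)).all fun e' =>
    (List.range (m / 3 + 1)).all fun c' => (List.range (m / 2 + 1)).all fun b' =>
      Nat.ble m (2 * b' + 2 * c' + 2 * e' + (e' + 1 + c') + e' + 1) ||
      (List.range m).any fun j =>
        balancedCheck m (m - (e' + 1 + c' + b') - (e' + 1 + c') - (e' + 1)) (e' + 1 + c' + b')
          (e' + 1 + c') (e' + 1) j &&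
        (List.range (min j (m - j))).any fun i =>
          balancedCheck m (m - (e' + 1 + c' + b') - (e' + 1 + c') - (e' + 1)) (e' + 1 + c' + b')
            (e' + 1 + c') (e' + 1) i) = true := by
  decide +kernel

lemma hasTwoBalanced_of_small {m a b c e : ℕ} (hm : 13 ≤ m) (hm' : m < 26)
    (hsum : a + b + c + e = m)
    (hab : b ≤ a) (hbc : c ≤ b) (hce : e ≤ c) (he : 0 < e) : HasTwoBalanced m a b c e := by
  have h := balancedCheck_small
  simp only [List.all_eq_true, List.mem_range, List.mem_range'_1] at h
  have h := h m (by omega) (e - 1) (by omega) (c - e) (by omega) (b - c) (by omega)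
  rw [show e - 1 + 1 = e by omega, show e + (c - e) = c by omega, show c + (b - c) = b by omega,
    show m - b - c - e = a by omega, Bool.or_eq_true, Nat.ble_eq, List.any_eq_true] at h
  rcases h with h | ⟨j, hj, h⟩
  · omega
  · rw [Bool.and_eq_true, List.any_eq_true] at h
    obtain ⟨h1, i, hi, h2⟩ := h
    rw [List.mem_range] at hi
    exact ⟨i, j, by omega, by omega, isBalanced_of_balancedCheck (by omega) h2,
      isBalanced_of_balancedCheck (by omega) h1⟩

theorem hasTwoBalanced {m a b c e : ℕ} (hm : 13 ≤ m) (hsum : a + b + c + e = m)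
    (hab : b ≤ a) (hbc : c ≤ b) (hce : e ≤ c) (he : 0 < e) : HasTwoBalanced m a b c e := by
  rcases lt_or_ge m 26 with hm' | hm'
  · exact hasTwoBalanced_of_small hm hm' hsum hab hbc hce he
  rcases lt_or_ge b (c + e) with hb | hb
  · rcases le_or_gt (2 * a) m with h | h
    · exact hasTwoBalanced_of_bulk hm' hsum hab hbc hce he h (by omega)
    · obtain ⟨k, hk0, hk1, hk2⟩ := exists_floor_div m (b + c + e) (by omega) (by omega)
      refine ⟨k + 1, k + 2, by omega, by nlinarith,
        isBalanced_of_lt_two_mul hsum hbc hce he hb hk2 (by nlinarith),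
        isBalanced_of_lt_two_mul hsum hbc hce he hb (by nlinarith) (by nlinarith)⟩
  rcases le_or_gt (3 * (c + e)) b with h3 | h3
  · obtain ⟨k, hk0, hk1, hk2⟩ := exists_floor_div m (c + e) (by omega) (by omega)
    have hk : 7 ≤ k := by
      by_contra! hcon
      have : (k + 1) * (c + e) ≤ 7 * (c + e) := Nat.mul_le_mul_right _ (by omega)
      omega
    have hkm : k * 2 ≤ m := le_trans (Nat.mul_le_mul_left k (by omega)) hk1
    obtain ⟨l, rfl⟩ : ∃ l, k = l + 4 := ⟨k - 4, by omega⟩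
    have h1 := isBalanced_or_pred (j := l + 3) hsum (by omega) (by omega) he hk1 (by linarith)
      (by linarith)
    have h2 := isBalanced_or_pred (j := l + 1) hsum (by omega) (by omega) he (by linarith)
      (by linarith) (by linarith)
    rcases h1 with h1 | h1 <;> rcases h2 with h2 | h2 <;>
      exact ⟨_, _, by omega, by omega, h2, h1⟩
  rcases le_or_gt (4 * (b + c + e)) m with h4 | h4
  · obtain ⟨n, hn0, hn1, hn2⟩ := exists_floor_div b (c + e) (by omega) hb
    obtain ⟨j, hj0, hj1, hj2⟩ := exists_floor_div (n * m) (b + c + e) (by omega) (by nlinarith)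
    have h5 : (j + 2) * b < n * m := by
      have h6 : b < 2 * (n * (c + e)) := by nlinarith
      have h7 : 2 * b * (b + c + e) < n * m * (c + e) := by
        have h8 : 2 * b * (b + c + e) < 2 * (2 * (n * (c + e))) * (b + c + e) :=
          Nat.mul_lt_mul_of_pos_right (by omega) (by omega)
        have h9 : n * (c + e) * (4 * (b + c + e)) ≤ n * (c + e) * m := Nat.mul_le_mul_left _ h4
        linarith
      apply lt_of_mul_lt_mul_right _ (Nat.zero_le (b + c + e))
      have h8 : b * (j * (b + c + e)) ≤ b * (n * m) := Nat.mul_le_mul_left _ hj1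
      linarith
    have h6 : (j + 2) * (c + e) < m := by
      apply lt_of_mul_lt_mul_right _ (Nat.zero_le b)
      have h7 : (j + 2) * b * (c + e) < n * m * (c + e) :=
        Nat.mul_lt_mul_of_pos_right h5 (by omega)
      have h8 : m * (n * (c + e)) ≤ m * b := Nat.mul_le_mul_left _ hn1
      linarith
    have h7 : (j + 2) * 2 ≤ (j + 2) * (c + e) := Nat.mul_le_mul_left _ (by omega)
    refine ⟨j + 1, j + 2, by omega, by omega,
      isBalanced_of_window (n := n) hsum (by omega) (by omega) he (by linarith) (by linarith)
        (by linarith),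
      isBalanced_of_window (n := n) hsum (by omega) (by omega) he h5 (by linarith) h6.le⟩
  rcases le_or_gt m (2 * a) with h5 | h5
  · exact hasTwoBalanced_of_wedge hm' hsum hab hbc hce he h5 hb h3 h4
  rcases le_or_gt (4 * (c + e)) m with h6 | h6
  · obtain ⟨k, hk0, hk1, hk2⟩ := exists_floor_div m (c + e) (by omega) (by omega)
    have hk : 4 ≤ k := by
      by_contra! hcon
      have : (k + 1) * (c + e) ≤ 4 * (c + e) := Nat.mul_le_mul_right _ (by omega)
      omega
    have hkm : k * 2 ≤ m := le_trans (Nat.mul_le_mul_left k (by omega)) hk1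
    obtain ⟨l, rfl⟩ : ∃ l, k = l + 4 := ⟨k - 4, by omega⟩
    have h1 := isBalanced_or_pred (j := l + 3) hsum (by omega) (by omega) he hk1 (by nlinarith)
      (by linarith)
    rcases h1 with h1 | h1 <;>
      exact ⟨2, _, by omega, by omega, isBalanced_two hab hbc hce he h5, h1⟩
  · exact hasTwoBalanced_of_bulk hm' hsum hab hbc hce he h5.le h6.le

/-- The sum of the residues of `n·x` modulo `m`, for `x` in `s`. -/
def residueSum (m : ℕ) (s : Multiset ℕ) (n : ℕ) : ℕ := (s.map fun x => n * x % m).sum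

/-- The dimension `d_n` attached to `s`, with `0` in place of `-1`. -/
def natDim (m : ℕ) (s : Multiset ℕ) (n : ℕ) : ℕ := residueSum m s n / m - 1

/-- The contribution of `n` to twice the right-hand side of the condition `(⋆)`. -/
def starTerm (m : ℕ) (s : Multiset ℕ) (n : ℕ) : ℕ :=
  natDim m s n * natDim m s (m - n) + if 2 * n = m then natDim m s n else 0

/-- Twice the right-hand side of the condition `(⋆)`. -/
def starSum (m : ℕ) (s : Multiset ℕ) : ℕ := ∑ n ∈ Ico 1 m, starTerm m s n

/-- The sum of the indicator functions of `j` and `m - j`. -/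
def pairIndicator (m j n : ℕ) : ℕ := (if n = j then 1 else 0) + if n = m - j then 1 else 0

lemma sum_pairIndicator {m j : ℕ} (hj : 0 < j) (hjm : j < m) :
    ∑ n ∈ Ico 1 m, pairIndicator m j n = 2 := by
  simp only [pairIndicator, sum_add_distrib, sum_ite_eq', mem_Ico]
  rw [if_pos (by omega), if_pos (by omega)]

lemma residue_facts {m j a f : ℕ} (hj : j < m) (h1 : f * m < j * a) (h2 : j * a < (f + 1) * m) :
    j * a % m + f * m = j * a ∧ j * a % m + (m - j) * a % m = m ∧ 0 < j * a % m := by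
  have hfa : f < a := by
    apply lt_of_mul_lt_mul_right _ (Nat.zero_le m)
    have := Nat.mul_le_mul_right a hj.le
    linarith
  obtain ⟨g, rfl⟩ : ∃ g, a = f + 1 + g := ⟨a - f - 1, by omega⟩
  obtain ⟨i, rfl⟩ : ∃ i, m = j + i := ⟨m - j, by omega⟩
  obtain ⟨r, hr⟩ := Nat.exists_eq_add_of_lt h1
  obtain ⟨r', hr'⟩ := Nat.exists_eq_add_of_lt h2
  have h3 : j * (f + 1 + g) % (j + i) = r + 1 := by
    rw [show j * (f + 1 + g) = r + 1 + f * (j + i) by linarith, Nat.add_mul_mod_self_right,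
      Nat.mod_eq_of_lt (by linarith)]
  have h4 : i * (f + 1 + g) % (j + i) = r' + 1 := by
    rw [show i * (f + 1 + g) = r' + 1 + g * (j + i) by linarith, Nat.add_mul_mod_self_right,
      Nat.mod_eq_of_lt (by linarith)]
  rw [Nat.add_sub_cancel_left, h3, h4]
  refine ⟨by linarith, by linarith, by omega⟩

lemma IsBalanced.two_le {m a b c e j : ℕ} (h : IsBalanced m a b c e j) : 2 ≤ j := by
  obtain ⟨f, g, h, i, -, -, -, -, h⟩ := h
  omega

lemma IsBalanced.residues {m a b c e j : ℕ} (h : IsBalanced m a b c e j)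
    (hsum : a + b + c + e = m) (hj : j < m) :
    j * a % m + j * b % m + j * c % m + j * e % m = 2 * m ∧
    (m - j) * a % m + (m - j) * b % m + (m - j) * c % m + (m - j) * e % m = 2 * m ∧
    j * c % m + (m - j) * c % m = m ∧ j * e % m + (m - j) * e % m = m := by
  obtain ⟨f, g, h, i, ha, hb, hc, he, hs⟩ := h
  obtain ⟨a1, a2, -⟩ := residue_facts hj ha.1 ha.2
  obtain ⟨b1, b2, -⟩ := residue_facts hj hb.1 hb.2
  obtain ⟨c1, c2, -⟩ := residue_facts hj hc.1 hc.2
  obtain ⟨e1, e2, -⟩ := residue_facts hj he.1 he.2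
  have h1 : (f + g + h + i + 2) * m = j * (a + b + c + e) := by rw [hs, hsum]
  have h2 : j * a % m + j * b % m + j * c % m + j * e % m = 2 * m := by linarith
  exact ⟨h2, by omega, c2, e2⟩

lemma one_le_natDim {m n : ℕ} {s : Multiset ℕ} (hm : 0 < m) (h : 2 * m ≤ residueSum m s n) :
    1 ≤ natDim m s n := by
  have := (Nat.le_div_iff_mul_le hm).2 h
  unfold natDim
  omega

lemma pairIndicator_le_starTerm {m j n : ℕ} {s : Multiset ℕ} (hj : j < m)
    (h1 : 1 ≤ natDim m s j) (h2 : 1 ≤ natDim m s (m - j)) :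
    pairIndicator m j n ≤ starTerm m s n := by
  have h3 : 1 ≤ natDim m s j * natDim m s (m - j) := Nat.mul_pos h1 h2
  unfold pairIndicator starTerm
  rcases eq_or_ne n j with rfl | hn
  · by_cases h : 2 * n = m
    · rw [if_pos rfl, if_pos (by omega), if_pos h]
      omega
    · rw [if_pos rfl, if_neg (by omega)]
      omega
  · rw [if_neg hn]
    by_cases h : n = m - j
    · subst h
      rw [if_pos rfl, show m - (m - j) = j by omega, mul_comm]
      omega
    · rw [if_neg h]
      omega

lemma mul_sum_mod_le (m n : ℕ) (s : Multiset ℕ) : n * s.sum % m ≤ residueSum m s n := by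
  induction s using Multiset.induction with
  | empty => simp
  | cons x s ih =>
    simp only [residueSum, Multiset.sum_cons, Multiset.map_cons, mul_add] at ih ⊢
    calc (n * x + n * s.sum) % m = (n * x % m + n * s.sum % m) % m := Nat.add_mod _ _ _
      _ ≤ n * x % m + n * s.sum % m := Nat.mod_le _ _
      _ ≤ _ := by omega

lemma residueSum_cons (m n x : ℕ) (s : Multiset ℕ) :
    residueSum m (x ::ₘ s) n = n * x % m + residueSum m s n := by
  simp [residueSum]

lemma natDim_merge_le (m n x y : ℕ) (s : Multiset ℕ) :
    natDim m ((x + y) ::ₘ s) n ≤ natDim m (x ::ₘ y ::ₘ s) n := by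
  have h : residueSum m ((x + y) ::ₘ s) n ≤ residueSum m (x ::ₘ y ::ₘ s) n := by
    simp only [residueSum_cons, mul_add]
    have := Nat.mod_le (n * x % m + n * y % m) m
    rw [← Nat.add_mod] at this
    omega
  exact Nat.sub_le_sub_right (Nat.div_le_div_right h) 1

lemma natDim_merge_lt {m n x y : ℕ} {s : Multiset ℕ} (hm : 0 < m)
    (h : m ≤ n * x % m + n * y % m) (h1 : 1 ≤ natDim m (x ::ₘ y ::ₘ s) n) :
    natDim m ((x + y) ::ₘ s) n < natDim m (x ::ₘ y ::ₘ s) n := by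
  have hx := Nat.mod_lt (n * x) hm
  have hy := Nat.mod_lt (n * y) hm
  have h2 : n * (x + y) % m + m = n * x % m + n * y % m := by
    rw [mul_add, Nat.add_mod, Nat.mod_eq_sub_mod h, Nat.mod_eq_of_lt (by omega)]
    omega
  have h3 : residueSum m (x ::ₘ y ::ₘ s) n = residueSum m ((x + y) ::ₘ s) n + m := by
    simp only [residueSum_cons]
    omega
  unfold natDim at h1 ⊢
  rw [h3, Nat.add_div_right _ hm] at h1 ⊢
  omega

lemma starTerm_merge {m j x y : ℕ} {s : Multiset ℕ} (hj : j < m)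
    (h1 : 1 ≤ natDim m (x ::ₘ y ::ₘ s) j) (h2 : 1 ≤ natDim m (x ::ₘ y ::ₘ s) (m - j))
    (hx : j * x % m + (m - j) * x % m = m) (hy : j * y % m + (m - j) * y % m = m) (n : ℕ) :
    starTerm m ((x + y) ::ₘ s) n + pairIndicator m j n ≤ starTerm m (x ::ₘ y ::ₘ s) n := by
  have hle := fun n => natDim_merge_le m n x y s
  have hm : 0 < m := by omega
  have hlt : natDim m ((x + y) ::ₘ s) j < natDim m (x ::ₘ y ::ₘ s) j ∨
      natDim m ((x + y) ::ₘ s) (m - j) < natDim m (x ::ₘ y ::ₘ s) (m - j) := by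
    rcases le_or_gt m (j * x % m + j * y % m) with h | h
    · exact Or.inl (natDim_merge_lt hm h h1)
    · exact Or.inr (natDim_merge_lt hm (by omega) h2)
  have h3 : 1 ≤ natDim m (x ::ₘ y ::ₘ s) j * natDim m (x ::ₘ y ::ₘ s) (m - j) := Nat.mul_pos h1 h2
  have hprod : natDim m ((x + y) ::ₘ s) j * natDim m ((x + y) ::ₘ s) (m - j) + 1 ≤
      natDim m (x ::ₘ y ::ₘ s) j * natDim m (x ::ₘ y ::ₘ s) (m - j) := by
    have ha := hle j
    have hb := hle (m - j)
    rcases hlt with h | h <;> nlinarith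
  unfold pairIndicator starTerm
  rcases eq_or_ne n j with rfl | hn
  · by_cases h : 2 * n = m
    · rw [if_pos rfl, if_pos h, if_pos h, if_pos (by omega)]
      rw [show m - n = n by omega, or_self] at hlt
      omega
    · rw [if_pos rfl, if_neg h, if_neg h, if_neg (by omega)]
      omega
  · rw [if_neg hn]
    by_cases h : n = m - j
    · subst h
      rw [if_pos rfl, show m - (m - j) = j by omega, if_neg (by omega), if_neg (by omega),
        mul_comm, mul_comm (natDim m (x ::ₘ y ::ₘ s) (m - j))]
      omega
    · rw [if_neg h]
      have := Nat.mul_le_mul (hle n) (hle (m - n))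
      have := hle n
      split_ifs <;> omega

lemma starSum_merge {m j x y : ℕ} {s : Multiset ℕ} (hj0 : 0 < j) (hj : j < m)
    (h1 : 1 ≤ natDim m (x ::ₘ y ::ₘ s) j) (h2 : 1 ≤ natDim m (x ::ₘ y ::ₘ s) (m - j))
    (hx : j * x % m + (m - j) * x % m = m) (hy : j * y % m + (m - j) * y % m = m) :
    starSum m ((x + y) ::ₘ s) + 2 ≤ starSum m (x ::ₘ y ::ₘ s) := by
  rw [← sum_pairIndicator hj0 hj, starSum, starSum, ← sum_add_distrib]
  exact sum_le_sum fun n _ => starTerm_merge hj h1 h2 hx hy n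

lemma four_le_starSum {m a b c e : ℕ} (hm : 13 ≤ m) (hsum : a + b + c + e = m) (hab : b ≤ a)
    (hbc : c ≤ b) (hce : e ≤ c) (he : 0 < e) : 4 ≤ starSum m {e, c, b, a} := by
  obtain ⟨i, j, hij, hm', hi, hj⟩ := hasTwoBalanced hm hsum hab hbc hce he
  have hi2 := hi.two_le
  have key : ∀ n, residueSum m {e, c, b, a} n = n * a % m + n * b % m + n * c % m + n * e % m := by
    intro n
    simp [residueSum]
    ring
  obtain ⟨i1, i2, -⟩ := hi.residues hsum (by omega)
  obtain ⟨j1, j2, -⟩ := hj.residues hsum (by omega)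
  have h4 : ∑ n ∈ Ico 1 m, (pairIndicator m i n + pairIndicator m j n) = 4 := by
    rw [sum_add_distrib, sum_pairIndicator (by omega) (by omega),
      sum_pairIndicator (by omega) (by omega)]
  rw [← h4, starSum]
  refine sum_le_sum fun n _ => ?_
  have hI := pairIndicator_le_starTerm (n := n) (show i < m by omega)
    (one_le_natDim (by omega) (by rw [key, i1])) (one_le_natDim (by omega) (by rw [key, i2]))
  have hJ := pairIndicator_le_starTerm (n := n) (show j < m by omega)
    (one_le_natDim (by omega) (by rw [key, j1])) (one_le_natDim (by omega) (by rw [key, j2]))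
  have h0 : pairIndicator m i n = 0 ∨ pairIndicator m j n = 0 := by
    unfold pairIndicator
    by_cases h : n = i ∨ n = m - i
    · right
      rw [if_neg (by omega), if_neg (by omega)]
    · left
      rw [if_neg (by omega), if_neg (by omega)]
  omega

lemma exists_sorted_list (s : Multiset ℕ) : ∃ l : List ℕ, l.Pairwise (· ≤ ·) ∧ s = ↑l :=
  ⟨s.sort (· ≤ ·), s.pairwise_sort _, (s.sort_eq _).symm⟩

/-- Two of the parts can be merged in such a way that `starSum` drops by at least two. -/
lemma exists_merge {m x y w r : ℕ} {s : Multiset ℕ} (hx : 0 < x) (hxy : x ≤ y) (hyw : y ≤ w)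
    (hyr : y ≤ r) (hsum : x + y + w + r = m) (hs : s.sum = r) :
    starSum m ((x + y) ::ₘ w ::ₘ s) + 2 ≤ starSum m (x ::ₘ y ::ₘ w ::ₘ s) := by
  obtain ⟨j, hj, hbal⟩ := exists_isBalanced (m := m) (a := max w r) (b := min w r) (c := y)
    (e := x) (by omega) (by omega) (by omega) hxy hx
  obtain ⟨h1, h2, h3, h4⟩ := hbal.residues (by omega) hj
  have hj2 := hbal.two_le
  have key : ∀ n, n * max w r % m + n * min w r % m + n * y % m + n * x % m = 2 * m →
      1 ≤ natDim m (x ::ₘ y ::ₘ w ::ₘ s) n := by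
    intro n hn
    apply one_le_natDim (by omega)
    have hmod := mul_sum_mod_le m n s
    rw [hs] at hmod
    simp only [residueSum_cons]
    rcases le_total w r with h | h
    · rw [max_eq_right h, min_eq_left h] at hn
      omega
    · rw [max_eq_left h, min_eq_right h] at hn
      omega
  exact starSum_merge (by omega) hj (key _ h1) (key _ h2) h4 h3

theorem le_starSum {m : ℕ} (hm : 13 ≤ m) (k : ℕ) : ∀ s : Multiset ℕ, s.card = k + 4 →
    (∀ x ∈ s, 0 < x) → s.sum = m → 2 * k + 4 ≤ starSum m s := by
  induction k with
  | zero =>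
    intro s hcard hpos hsum
    obtain ⟨l, hsort, rfl⟩ := exists_sorted_list s
    rw [Multiset.coe_card] at hcard
    match l, hcard with
    | [e, c, b, a], _ =>
      simp at hsort hsum hpos
      exact four_le_starSum hm (by omega) (by omega) (by omega) (by omega) (by omega)
  | succ k ih =>
    intro s hcard hpos hsum
    obtain ⟨l, hsort, rfl⟩ := exists_sorted_list s
    rw [Multiset.coe_card] at hcard
    match l, hcard with
    | x :: y :: w :: v :: l, hcard =>
      simp only [List.pairwise_cons, List.mem_cons, forall_eq_or_imp, List.length_cons,
        Multiset.mem_coe, Multiset.sum_coe, List.sum_cons] at hsort hcard hpos hsum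
      have hmerge := exists_merge (m := m) (x := x) (y := y) (w := w) (r := v + l.sum)
        (s := ↑(v :: l)) (by omega) (by omega) (by omega) (by omega) (by omega) (by simp)
      have := ih ((x + y) ::ₘ w ::ₘ ↑(v :: l)) (by simp; omega)
        (by
          simp only [Multiset.mem_cons, Multiset.mem_coe, List.mem_cons, forall_eq_or_imp]
          exact ⟨by omega, hpos.2.2⟩)
        (by simp; omega)
      simp only [Multiset.cons_coe] at this hmerge ⊢
      omega

lemma exists_perm_of_map_eq {N : ℕ} {f g : Fin N → ℕ}
    (h : (univ : Finset (Fin N)).val.map f = (univ : Finset (Fin N)).val.map g) :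
    ∃ σ : Equiv.Perm (Fin N), ∀ i, f i = g (σ i) := by
  have hcard : ∀ c, Fintype.card {i // f i = c} = Fintype.card {i // g i = c} := by
    intro c
    have := congrArg (Multiset.count c) h
    rw [Multiset.count_map, Multiset.count_map] at this
    simp only [Fintype.card_subtype, eq_comm (b := c)]
    exact this
  exact ⟨Equiv.ofFiberEquiv fun c => Fintype.equivOfCardEq (hcard c),
    fun i => (Equiv.ofFiberEquiv_map _ i).symm⟩

/-- The conditions on a triple, for the multiset of the `a_i`; the gcd condition is replaced by its
consequence that no residue sum vanishes. -/
structure IsAdmissible (m : ℕ) (s : Multiset ℕ) : Prop where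
  two_le : 2 ≤ m
  four_le : 4 ≤ s.card
  pos : ∀ x ∈ s, 0 < x
  lt : ∀ x ∈ s, x < m
  dvd : m ∣ s.sum
  ne_zero : ∀ n, 0 < n → n < m → residueSum m s n ≠ 0

lemma dvd_residueSum {m : ℕ} {s : Multiset ℕ} (h : m ∣ s.sum) (n : ℕ) : m ∣ residueSum m s n := by
  have h1 : residueSum m s n ≡ n * s.sum [MOD m] := by
    clear h
    induction s using Multiset.induction with
    | empty => simp [residueSum, Nat.ModEq]
    | cons x s ih =>
      rw [residueSum_cons, Multiset.sum_cons, mul_add]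
      exact (Nat.mod_modEq _ _).add ih
  exact (h1.dvd_iff dvd_rfl).2 (h.mul_left n)

lemma IsAdmissible.residueSum_eq {m n : ℕ} {s : Multiset ℕ} (h : IsAdmissible m s) (h0 : 0 < n)
    (h1 : n < m) : residueSum m s n = m * (natDim m s n + 1) := by
  obtain ⟨q, hq⟩ := dvd_residueSum h.dvd n
  have hm : 0 < m := by omega
  have hne := h.ne_zero n h0 h1
  rw [natDim, hq, Nat.mul_div_cancel_left _ hm]
  rcases q with _ | q
  · simp [hq] at hne
  · simp

lemma residueSum_reflect {m t : ℕ} {s : Multiset ℕ} (ht : t ≤ m) (hcop : Nat.Coprime t m)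
    (hpos : ∀ x ∈ s, 0 < x) (hlt : ∀ x ∈ s, x < m) :
    residueSum m s t + residueSum m s (m - t) = s.card * m := by
  induction s using Multiset.induction with
  | empty => simp [residueSum]
  | cons x s ih =>
    have ih := ih (fun y hy => hpos y (Multiset.mem_cons_of_mem hy))
      fun y hy => hlt y (Multiset.mem_cons_of_mem hy)
    have hx := hpos x (Multiset.mem_cons_self x s)
    have hxm := hlt x (Multiset.mem_cons_self x s)
    have hm : 0 < m := by omega
    have h1 : 0 < t * x % m := Nat.pos_of_ne_zero fun h0 =>
      Nat.not_dvd_of_pos_of_lt hx hxm (hcop.symm.dvd_of_dvd_mul_left (Nat.dvd_of_mod_eq_zero h0))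
    have h2 : m ∣ t * x % m + (m - t) * x % m := by
      rw [Nat.dvd_iff_mod_eq_zero, ← Nat.add_mod, ← add_mul, Nat.add_sub_cancel' ht,
        Nat.mul_mod_right]
    have h3 := Nat.mod_lt (t * x) hm
    have h4 := Nat.mod_lt ((m - t) * x) hm
    have h5 : t * x % m + (m - t) * x % m = m :=
      Nat.eq_of_dvd_of_lt_two_mul (by omega) h2 (by omega)
    rw [residueSum_cons, residueSum_cons, Multiset.card_cons, add_mul]
    omega

lemma IsAdmissible.natDim_add {m t : ℕ} {s : Multiset ℕ} (h : IsAdmissible m s) (h0 : 0 < t)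
    (h1 : t < m) (hcop : Nat.Coprime t m) :
    natDim m s t + natDim m s (m - t) + 2 = s.card := by
  have h2 := residueSum_reflect h1.le hcop h.pos h.lt
  rw [h.residueSum_eq h0 h1, h.residueSum_eq (n := m - t) (by omega) (by omega)] at h2
  apply Nat.eq_of_mul_eq_mul_right (show 0 < m by omega)
  linarith

lemma residueSum_map_mul (m t n : ℕ) (s : Multiset ℕ) :
    residueSum m (s.map fun x => t * x % m) n = residueSum m s (t * n % m) := by
  unfold residueSum
  rw [Multiset.map_map]
  congr 1
  refine Multiset.map_congr rfl fun x _ => ?_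
  simp only [Function.comp_apply, Nat.mul_mod_mod, Nat.mod_mul_mod]
  ring_nf

lemma mul_mod_pos {m t n : ℕ} (hcop : Nat.Coprime t m) (h0 : 0 < n) (h1 : n < m) :
    0 < t * n % m := Nat.pos_of_ne_zero fun h =>
  Nat.not_dvd_of_pos_of_lt h0 h1 (hcop.symm.dvd_of_dvd_mul_left (Nat.dvd_of_mod_eq_zero h))

lemma mul_mod_reflect {m t n : ℕ} (hcop : Nat.Coprime t m) (h0 : 0 < n) (h1 : n < m) :
    t * (m - n) % m = m - t * n % m := by
  have h2 := mul_mod_pos hcop h0 h1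
  have h3 := Nat.mod_lt (t * n) (show 0 < m by omega)
  have h4 := mul_mod_pos hcop (show 0 < m - n by omega) (by omega)
  have h5 := Nat.mod_lt (t * (m - n)) (show 0 < m by omega)
  have h6 : m ∣ t * (m - n) % m + t * n % m := by
    rw [Nat.dvd_iff_mod_eq_zero, ← Nat.add_mod, ← mul_add, Nat.sub_add_cancel h1.le,
      Nat.mul_mod_left]
  have := Nat.eq_of_dvd_of_lt_two_mul (by omega) h6 (by omega)
  omega

lemma starSum_map_mul {m t : ℕ} (hcop : Nat.Coprime t m) (s : Multiset ℕ) :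
    starSum m (s.map fun x => t * x % m) = starSum m s := by
  have hmaps : Set.MapsTo (fun n => t * n % m) (Ico 1 m : Set ℕ) (Ico 1 m : Set ℕ) := by
    intro n hn
    simp only [coe_Ico, Set.mem_Ico] at hn ⊢
    exact ⟨mul_mod_pos hcop hn.1 hn.2, Nat.mod_lt _ (by omega)⟩
  have hinj : Set.InjOn (fun n => t * n % m) (Ico 1 m : Set ℕ) := by
    intro n hn n' hn' h
    simp only [coe_Ico, Set.mem_Ico] at hn hn'
    exact Nat.ModEq.eq_of_lt_of_lt (Nat.ModEq.cancel_left_of_coprime hcop.symm h) hn.2 hn'.2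
  refine sum_nbij (fun n => t * n % m) hmaps hinj
    (surjOn_of_injOn_of_card_le _ hmaps hinj le_rfl) fun n hn => ?_
  rw [mem_Ico] at hn
  have h2 : 2 * n = m ↔ 2 * (t * n % m) = m := by
    have hr := mul_mod_reflect hcop hn.1 hn.2
    constructor
    · intro h
      rw [show m - n = n by omega] at hr
      have := Nat.mod_lt (t * n) (show 0 < m by omega)
      omega
    · intro h
      have h3 : t * (m - n) % m = t * n % m := by omega
      have := Nat.ModEq.eq_of_lt_of_lt (Nat.ModEq.cancel_left_of_coprime hcop.symm h3)
        (by omega) hn.2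
      omega
  simp only [starTerm, natDim, residueSum_map_mul, mul_mod_reflect hcop hn.1 hn.2, h2]

lemma IsAdmissible.map_mul {m t : ℕ} {s : Multiset ℕ} (h : IsAdmissible m s)
    (hcop : Nat.Coprime t m) : IsAdmissible m (s.map fun x => t * x % m) where
  two_le := h.two_le
  four_le := by rw [Multiset.card_map]; exact h.four_le
  pos x hx := by
    obtain ⟨y, hy, rfl⟩ := Multiset.mem_map.1 hx
    exact mul_mod_pos hcop (h.pos y hy) (h.lt y hy)
  lt x hx := by
    obtain ⟨y, hy, rfl⟩ := Multiset.mem_map.1 hx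
    exact Nat.mod_lt _ (by have := h.two_le; omega)
  dvd := dvd_residueSum h.dvd t
  ne_zero n h0 h1 := by
    rw [residueSum_map_mul]
    exact h.ne_zero _ (mul_mod_pos hcop h0 h1) (Nat.mod_lt _ (by omega))

lemma exists_unit {m : ℕ} (hm : 3 ≤ m) (h3 : m ≠ 3) (h4 : m ≠ 4) (h6 : m ≠ 6) :
    ∃ t, 1 < t ∧ t + 1 < m ∧ Nat.Coprime t m := by
  rcases Nat.even_or_odd' m with ⟨k, rfl | rfl⟩
  · rcases Nat.even_or_odd' k with ⟨l, rfl | rfl⟩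
    · refine ⟨2 * l - 1, by omega, by omega, ?_⟩
      obtain ⟨i, rfl⟩ : ∃ i, l = i + 1 := ⟨l - 1, by omega⟩
      rw [show 2 * (2 * (i + 1)) = 2 + 2 * (2 * (i + 1) - 1) by omega,
        Nat.coprime_add_mul_right_right, Nat.coprime_two_right]
      exact ⟨i, by omega⟩
    · refine ⟨2 * l - 1, by omega, by omega, ?_⟩
      obtain ⟨i, rfl⟩ : ∃ i, l = i + 1 := ⟨l - 1, by omega⟩
      rw [show 2 * (2 * (i + 1) + 1) = 2 ^ 2 + 2 * (2 * (i + 1) - 1) by omega,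
        Nat.coprime_add_mul_right_right]
      exact Nat.Coprime.pow_right 2 (Nat.coprime_two_right.2 ⟨i, by omega⟩)
  · exact ⟨2, by omega, by omega, Nat.coprime_two_left.2 ⟨k, rfl⟩⟩

lemma IsAdmissible.exists_residueSum_eq {m : ℕ} {s : Multiset ℕ} (h : IsAdmissible m s)
    (hm : 3 ≤ m) (hstar : starSum m s + 6 = 2 * s.card) :
    ∃ t, Nat.Coprime t m ∧ (residueSum m s t = m ∨
      ((m = 3 ∨ m = 4 ∨ m = 6) ∧ residueSum m s t = 2 * m)) := by
  have hneg : ∀ t, t ≤ m → Nat.Coprime t m → Nat.Coprime (m - t) m := fun t ht hc =>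
    (Nat.coprime_self_sub_left ht).2 hc
  have hcop1 : Nat.Coprime 1 m := Nat.coprime_one_left m
  have key : ∀ t, 0 < t → t < m → Nat.Coprime t m →
      natDim m s t = 0 ∨ natDim m s (m - t) = 0 → ∃ t, Nat.Coprime t m ∧ residueSum m s t = m := by
    rintro t h0 h1 hc (hd | hd)
    · exact ⟨t, hc, by rw [h.residueSum_eq h0 h1, hd, zero_add, mul_one]⟩
    · exact ⟨m - t, hneg t h1.le hc, by
        rw [h.residueSum_eq (n := m - t) (by omega) (by omega), hd, zero_add, mul_one]⟩
  suffices (∃ t, Nat.Coprime t m ∧ residueSum m s t = m) ∨ ∃ t, Nat.Coprime t m ∧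
      (m = 3 ∨ m = 4 ∨ m = 6) ∧ residueSum m s t = 2 * m by
    rcases this with ⟨t, hc, ht⟩ | ⟨t, hc, hm', ht⟩
    · exact ⟨t, hc, Or.inl ht⟩
    · exact ⟨t, hc, Or.inr ⟨hm', ht⟩⟩
  have hadd := h.natDim_add (t := 1) (by omega) (by omega) hcop1
  have hpair : ∀ t, natDim m s t * natDim m s (m - t) ≤ starTerm m s t := fun t =>
    Nat.le_add_right _ _
  have h2 : starTerm m s 1 + starTerm m s (m - 1) ≤ starSum m s := by
    rw [← sum_pair (show 1 ≠ m - 1 by omega)]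
    refine sum_le_sum_of_subset fun n hn => ?_
    simp only [mem_insert, mem_singleton] at hn
    rw [mem_Ico]
    omega
  have hp1 := hpair 1
  have hp2 := hpair (m - 1)
  rw [show m - (m - 1) = 1 by omega, mul_comm] at hp2
  have hcases : natDim m s 1 = 0 ∨ natDim m s (m - 1) = 0 ∨ natDim m s 1 = 1 ∨
      natDim m s (m - 1) = 1 := by
    by_contra! hcon
    obtain ⟨c1, c2, c3, c4⟩ := hcon
    have h3 : natDim m s 1 * natDim m s (m - 1) + 3 ≤ s.card := by omega
    obtain ⟨p, hp⟩ : ∃ p, natDim m s 1 = p + 2 := ⟨natDim m s 1 - 2, by omega⟩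
    obtain ⟨q, hq⟩ : ∃ q, natDim m s (m - 1) = q + 2 := ⟨natDim m s (m - 1) - 2, by omega⟩
    rw [hp, hq] at h3 hadd
    nlinarith
  rw [← or_assoc] at hcases
  rcases hcases with h0 | hone
  · exact Or.inl (key 1 (by omega) (by omega) hcop1 h0)
  have hprod : natDim m s 1 * natDim m s (m - 1) + 3 = s.card := by
    rcases hone with h1 | h1 <;> rw [h1] at hadd ⊢ <;> omega
  by_cases hsmall : m = 3 ∨ m = 4 ∨ m = 6
  · right
    rcases hone with h1 | h1
    · exact ⟨1, hcop1, hsmall, by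
        rw [h.residueSum_eq (n := 1) (by omega) (by omega), h1, mul_comm]⟩
    · exact ⟨m - 1, hneg 1 (by omega) hcop1, hsmall, by
        rw [h.residueSum_eq (n := m - 1) (by omega) (by omega), h1, mul_comm]⟩
  · left
    obtain ⟨t, ht1, htm, hc⟩ := exists_unit hm (by omega) (by omega) (by omega)
    refine key t (by omega) (by omega) hc ?_
    have h3 : starTerm m s 1 + (starTerm m s (m - 1) + starTerm m s t) ≤ starSum m s := by
      rw [← sum_pair (show m - 1 ≠ t by omega),
        ← sum_insert (show 1 ∉ ({m - 1, t} : Finset ℕ) by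
          simp only [mem_insert, mem_singleton]; omega)]
      refine sum_le_sum_of_subset fun n hn => ?_
      simp only [mem_insert, mem_singleton] at hn
      rw [mem_Ico]
      omega
    have hp3 := hpair t
    exact Nat.mul_eq_zero.1 (by omega)

/-- All lists with entries in `{1, …, k}`, in decreasing order, whose sum is `n`. -/
def boundedParts : ℕ → ℕ → List (List ℕ)
  | 0, n => if n = 0 then [[]] else []
  | k + 1, n => (List.range (n / (k + 1) + 1)).flatMap fun i =>
      (boundedParts k (n - i * (k + 1))).map (List.replicate i (k + 1) ++ ·)

lemma exists_mem_boundedParts (k : ℕ) : ∀ s : Multiset ℕ, (∀ x ∈ s, 0 < x ∧ x ≤ k) →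
    ∃ l ∈ boundedParts k s.sum, s = ↑l := by
  induction k with
  | zero =>
    intro s hs
    have : s = 0 := Multiset.eq_zero_of_forall_notMem fun x hx => by have := hs x hx; omega
    exact ⟨[], by simp [this, boundedParts], by simp [this]⟩
  | succ k ih =>
    intro s hs
    have hsplit := Multiset.filter_add_not (fun x => x = k + 1) s
    rw [Multiset.filter_eq'] at hsplit
    obtain ⟨l, hl, hl'⟩ := ih (s.filter fun x => ¬ x = k + 1) fun x hx => by
      rw [Multiset.mem_filter] at hx
      have := hs x hx.1
      omega
    have hsum : s.sum = s.count (k + 1) * (k + 1) + (s.filter fun x => ¬ x = k + 1).sum := by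
      conv_lhs => rw [← hsplit]
      simp
    refine ⟨List.replicate (s.count (k + 1)) (k + 1) ++ l, ?_, ?_⟩
    · rw [boundedParts, List.mem_flatMap]
      refine ⟨s.count (k + 1), ?_, List.mem_map.2 ⟨l, ?_, rfl⟩⟩
      · rw [List.mem_range, Nat.lt_succ_iff, Nat.le_div_iff_mul_le (by omega)]
        omega
      · rwa [hsum, Nat.add_sub_cancel_left]
    · conv_lhs => rw [← hsplit]
      rw [hl', ← Multiset.coe_add, Multiset.coe_replicate]

/-- Checks that every admissible solution of `(⋆)` with entries in `{1, …, m - 1}` and sum `S` is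
equivalent to a listed one. -/
def smallCheck (m S : ℕ) : Bool :=
  (boundedParts (m - 1) S).all fun l =>
    (l.length.blt 4) || (((List.range m).any fun n => (0).blt n && (residueSum m ↑l n).beq 0) ||
      (!(starSum m ↑l + 6).beq (2 * l.length) ||
        twentyTriples.any fun p => p.1.beq m && (List.range m).any fun t =>
          (t.gcd m).beq 1 && (l.map fun x => t * x % m).isPerm p.2))

set_option maxRecDepth 100000 in
lemma smallCheck_eq : ((List.range' 3 10).all fun m => smallCheck m m &&
    (!(m.beq 3 || m.beq 4 || m.beq 6) || smallCheck m (2 * m))) = true := by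
  decide +kernel

lemma IsAdmissible.exists_twentyTriples_of_smallCheck {m S : ℕ} {s : Multiset ℕ}
    (h : IsAdmissible m s) (hstar : starSum m s + 6 = 2 * s.card) (hS : s.sum = S)
    (hcheck : smallCheck m S = true) :
    ∃ p ∈ twentyTriples, p.1 = m ∧ ∃ t, Nat.Coprime t m ∧ s.map (fun x => t * x % m) = ↑p.2 := by
  subst hS
  obtain ⟨l, hl, hsl⟩ := exists_mem_boundedParts (m - 1) s fun x hx => ⟨h.pos x hx, by
    have := h.lt x hx
    omega⟩
  rw [smallCheck, List.all_eq_true] at hcheck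
  replace hcheck := hcheck l hl
  subst hsl
  have h4 := h.four_le
  rw [Multiset.coe_card] at h4 hstar
  simp only [Bool.or_eq_true, List.any_eq_true, Bool.and_eq_true, Bool.not_eq_true',
    Nat.beq_eq, Nat.blt, Nat.ble_eq, List.mem_range, List.isPerm_iff] at hcheck
  rcases hcheck with hc | ⟨n, hn, h0, hr⟩ | hc | ⟨p, hp, hpm, t, -, hc, hperm⟩
  · omega
  · exact absurd hr (h.ne_zero n h0 hn)
  · rw [hstar] at hc
    simp at hc
  · exact ⟨p, hp, hpm, t, hc, by rw [Multiset.map_coe, Multiset.coe_eq_coe]; exact hperm⟩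

lemma IsAdmissible.exists_twentyTriples_of_two {s : Multiset ℕ} (h : IsAdmissible 2 s)
    (hstar : starSum 2 s + 6 = 2 * s.card) :
    ∃ p ∈ twentyTriples, p.1 = 2 ∧ ∃ t, Nat.Coprime t 2 ∧ s.map (fun x => t * x % 2) = ↑p.2 := by
  obtain ⟨n, rfl⟩ : ∃ n, s = Multiset.replicate n 1 :=
    ⟨_, Multiset.eq_replicate_card.2 fun x hx => by
      have := h.pos x hx
      have := h.lt x hx
      omega⟩
  have hdvd := h.dvd
  have h4 := h.four_le
  simp only [Multiset.sum_replicate, smul_eq_mul, mul_one, Multiset.card_replicate] at *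
  obtain ⟨k, rfl⟩ := hdvd
  obtain ⟨i, rfl⟩ : ∃ i, k = i + 1 := ⟨k - 1, by omega⟩
  have hdim : natDim 2 (Multiset.replicate (2 * (i + 1)) 1) 1 = i := by
    simp [natDim, residueSum]
  have hsum : starSum 2 (Multiset.replicate (2 * (i + 1)) 1) = i * i + i := by
    simp [starSum, starTerm, hdim]
  rw [hsum] at hstar
  have hi : i = 1 ∨ i = 2 := by
    have : i < 3 := by nlinarith
    interval_cases i <;> omega
  rcases hi with rfl | rfl
  · exact ⟨(2, [1, 1, 1, 1]), by decide, rfl, 1, by decide, by decide⟩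
  · exact ⟨(2, [1, 1, 1, 1, 1, 1]), by decide, rfl, 1, by decide, by decide⟩

theorem IsAdmissible.exists_twentyTriples {m : ℕ} {s : Multiset ℕ} (h : IsAdmissible m s)
    (hstar : starSum m s + 6 = 2 * s.card) :
    ∃ p ∈ twentyTriples, p.1 = m ∧ ∃ t, Nat.Coprime t m ∧ s.map (fun x => t * x % m) = ↑p.2 := by
  have h2 := h.two_le
  rcases h2.eq_or_lt with rfl | hm
  · exact h.exists_twentyTriples_of_two hstar
  obtain ⟨t, hc, ht⟩ := h.exists_residueSum_eq hm hstar
  have h' := h.map_mul hc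
  have hstar' : starSum m (s.map fun x => t * x % m) + 6 =
      2 * (s.map fun x => t * x % m).card := by
    rw [starSum_map_mul hc, Multiset.card_map, hstar]
  have hmain : ∃ p ∈ twentyTriples, p.1 = m ∧ ∃ t', Nat.Coprime t' m ∧
      (s.map fun x => t * x % m).map (fun x => t' * x % m) = ↑p.2 := by
    rcases lt_or_ge m 13 with hm13 | hm13
    · have hcheck := smallCheck_eq
      rw [List.all_eq_true] at hcheck
      replace hcheck := hcheck m (by rw [List.mem_range'_1]; omega)
      simp only [Bool.and_eq_true, Bool.or_eq_true, Bool.not_eq_true',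
        Bool.or_eq_false_iff] at hcheck
      rcases ht with ht | ⟨hm', ht⟩
      · exact h'.exists_twentyTriples_of_smallCheck hstar' ht hcheck.1
      · refine h'.exists_twentyTriples_of_smallCheck hstar' ht (hcheck.2.resolve_left ?_)
        rcases hm' with rfl | rfl | rfl <;> decide
    · rcases ht with ht | ⟨hm', -⟩
      · have h4 := h'.four_le
        have := le_starSum hm13 ((s.map fun x => t * x % m).card - 4) _ (by omega) h'.pos ht
        omega
      · omega
  obtain ⟨p, hp, hpm, t', hc', heq⟩ := hmain
  refine ⟨p, hp, hpm, t' * t, Nat.Coprime.mul_left hc' hc, ?_⟩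
  rw [← heq, Multiset.map_map]
  refine Multiset.map_congr rfl fun x _ => ?_
  simp only [Function.comp_apply, Nat.mul_mod_mod, mul_assoc]

lemma sum_Ico_of_reflect (m : ℕ) (hm : 2 ≤ m) (f : ℕ → ℕ)
    (hf : ∀ n, 0 < n → n < m → f (m - n) = f n) :
    ∑ n ∈ Ico 1 m, f n =
      2 * ∑ n ∈ Icc 1 ((m - 1) / 2), f n + if m % 2 = 0 then f (m / 2) else 0 := by
  obtain ⟨k, hk⟩ : ∃ k, (m - 1) / 2 = k := ⟨_, rfl⟩
  have hIcc : Icc 1 k = Ico 1 (k + 1) := by ext; simp only [mem_Icc, mem_Ico]; omega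
  rw [hk, hIcc, ← sum_Ico_consecutive f (show 1 ≤ k + 1 by omega) (show k + 1 ≤ m by omega),
    ← sum_Ico_consecutive f (show k + 1 ≤ m - k by omega) (show m - k ≤ m by omega)]
  have h1 := sum_Ico_reflect f 1 (show k + 1 ≤ m + 1 by omega)
  rw [show m + 1 - (k + 1) = m - k by omega, show m + 1 - 1 = m by omega] at h1
  rw [← h1, sum_congr rfl fun n hn => hf n (by rw [mem_Ico] at hn; omega)
    (by rw [mem_Ico] at hn; omega)]
  split_ifs with h
  · rw [show m - k = k + 1 + 1 by omega, show m / 2 = k + 1 by omega]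
    simp
    ring
  · rw [show m - k = k + 1 by omega, Ico_self, sum_empty]
    ring

lemma residueSum_map_univ (m N : ℕ) (b : Fin N → ℕ) (n : ℕ) :
    residueSum m ((univ : Finset (Fin N)).val.map b) n = ∑ i, n * b i % m := by
  rw [residueSum, Multiset.map_map]
  rfl

lemma isAdmissible_of_isTriple {m N : ℕ} {b : Fin N → ℕ}
    (h : IsTriple m N fun i => (b i : ℤ)) :
    IsAdmissible m ((univ : Finset (Fin N)).val.map b) := by
  obtain ⟨hm, hN, hb, hgcd, hdvd⟩ := h
  have hmem : ∀ x ∈ (univ : Finset (Fin N)).val.map b, ∃ i, b i = x := fun x hx => by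
    obtain ⟨i, -, hi⟩ := Multiset.mem_map.1 hx
    exact ⟨i, hi⟩
  refine ⟨hm, by simpa using hN, fun x hx => ?_, fun x hx => ?_, ?_, fun n h0 h1 hr => ?_⟩
  · obtain ⟨i, rfl⟩ := hmem x hx
    have : 1 ≤ (b i : ℤ) ∧ (b i : ℤ) ≤ m - 1 := hb i
    omega
  · obtain ⟨i, rfl⟩ := hmem x hx
    have : 1 ≤ (b i : ℤ) ∧ (b i : ℤ) ≤ m - 1 := hb i
    omega
  · have : (m : ℤ) ∣ ((∑ i, b i : ℕ) : ℤ) := by simpa using hdvd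
    exact Int.natCast_dvd_natCast.1 this
  · rw [residueSum_map_univ, sum_eq_zero_iff] at hr
    have h2 : ∀ i, (m : ℤ) ∣ n * (b i : ℤ) := fun i => by
      exact_mod_cast Nat.dvd_of_mod_eq_zero (hr i (mem_univ i))
    have h3 : (m : ℤ) ∣ n * univ.gcd fun i => (b i : ℤ) := by
      have := Finset.dvd_gcd (s := univ) (f := fun i => (n : ℤ) * (b i : ℤ)) fun i _ => h2 i
      rwa [Finset.gcd_mul_left, Int.normalize_coe_nat] at this
    have h4 : (m : ℤ) ∣ n := (Int.isCoprime_iff_gcd_eq_one.2 hgcd).dvd_of_dvd_mul_right h3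
    exact Nat.not_dvd_of_pos_of_lt h0 h1 (Int.natCast_dvd_natCast.1 h4)

lemma hodgeDim_eq {m N n : ℕ} {b : Fin N → ℕ}
    (h : IsAdmissible m ((univ : Finset (Fin N)).val.map b)) (h0 : 0 < n) (h1 : n < m) :
    hodgeDim m N (fun i => (b i : ℤ)) n = natDim m ((univ : Finset (Fin N)).val.map b) n := by
  have h2 := h.residueSum_eq h0 h1
  rw [residueSum_map_univ] at h2
  have h3 : (∑ i, ((n : ℤ) * (b i : ℤ)) % (m : ℤ)) = ((∑ i, n * b i % m : ℕ) : ℤ) := by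
    push_cast
    rfl
  have hm : (m : ℚ) ≠ 0 := by
    have : m ≠ 0 := by omega
    exact_mod_cast this
  rw [hodgeDim, h3, h2]
  push_cast
  rw [mul_div_cancel_left₀ _ hm]
  ring

lemma starSum_eq_of_condStar {m N : ℕ} {b : Fin N → ℕ}
    (h : IsAdmissible m ((univ : Finset (Fin N)).val.map b))
    (hstar : CondStar m N fun i => (b i : ℤ)) :
    starSum m ((univ : Finset (Fin N)).val.map b) + 6 =
      2 * ((univ : Finset (Fin N)).val.map b).card := by
  have hm := h.two_le
  rw [starSum, sum_Ico_of_reflect m hm]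
  swap
  · intro n h0 h1
    rw [starTerm, starTerm, show m - (m - n) = n by omega, mul_comm]
    by_cases h2 : 2 * n = m
    · rw [show m - n = n by omega]
    · rw [if_neg h2, if_neg (by omega)]
  have h1 : ∀ n ∈ Icc 1 ((m - 1) / 2),
      hodgeDim m N (fun i => (b i : ℤ)) n * hodgeDim m N (fun i => (b i : ℤ)) ((m : ℤ) - n) =
        (starTerm m ((univ : Finset (Fin N)).val.map b) n : ℚ) := by
    intro n hn
    rw [mem_Icc] at hn
    rw [show (m : ℤ) - n = ((m - n : ℕ) : ℤ) by omega, hodgeDim_eq h (by omega) (by omega),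
      hodgeDim_eq h (by omega) (by omega), starTerm, if_neg (by omega)]
    push_cast
    ring
  rw [CondStar, sum_congr rfl h1] at hstar
  rw [Multiset.card_map, card_val, card_univ, Fintype.card_fin]
  have h2 : (if m % 2 = 0 then hodgeDim m N (fun i => (b i : ℤ)) (m / 2) *
      (hodgeDim m N (fun i => (b i : ℤ)) (m / 2) + 1) / 2 else 0) =
      ((if m % 2 = 0 then starTerm m ((univ : Finset (Fin N)).val.map b) (m / 2) else 0 : ℕ) : ℚ)
        / 2 := by
    split_ifs with heven
    · rw [show (m : ℤ) / 2 = ((m / 2 : ℕ) : ℤ) by omega, hodgeDim_eq h (by omega) (by omega),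
        starTerm, show m - m / 2 = m / 2 by omega, if_pos (by omega)]
      push_cast
      ring
    · simp
  rw [h2] at hstar
  have : ((2 * ∑ n ∈ Icc 1 ((m - 1) / 2), starTerm m ((univ : Finset (Fin N)).val.map b) n +
      (if m % 2 = 0 then starTerm m ((univ : Finset (Fin N)).val.map b) (m / 2) else 0) + 6 : ℕ)
      : ℚ) = ((2 * N : ℕ) : ℚ) := by
    rw [Nat.cast_add, Nat.cast_add, Nat.cast_mul, Nat.cast_sum]
    push_cast at hstar ⊢
    linarith
  exact_mod_cast this

/-- Suppose the triple `(m, N, a)` satisfies condition (⋆). Then `(m, N, a)` is equivalent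
to one of the twenty listed triples. -/
theorem star_solutions_classification (m N : ℕ) (a : Fin N → ℤ)
    (htriple : IsTriple m N a) (hstar : CondStar m N a) :
    ∃ p ∈ twentyTriples, m = p.1 ∧ ∃ hN : N = p.2.length,
      EquivTuple m N a (fun i => (p.2.get (Fin.cast hN i) : ℤ)) := by
  lift a to Fin N → ℕ using fun i => by
    have := (htriple.2.2.1 i).1
    omega
  have hadm := isAdmissible_of_isTriple htriple
  obtain ⟨p, hp, hpm, t, hc, hmap⟩ :=
    hadm.exists_twentyTriples (starSum_eq_of_condStar hadm hstar)
  have hN : N = p.2.length := by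
    simpa using congrArg Multiset.card hmap
  refine ⟨p, hp, hpm.symm, hN, t, by simpa using hc, ?_⟩
  subst hN
  have hget : (univ : Finset (Fin p.2.length)).val.map p.2.get =
      (univ : Finset (Fin p.2.length)).val.map fun i => t * a i % m := by
    rw [Multiset.map_map] at hmap
    rw [Fin.univ_val_map, List.ofFn_get]
    exact hmap.symm
  obtain ⟨σ, hσ⟩ := exists_perm_of_map_eq hget
  refine ⟨σ, fun i => ?_⟩
  have h := hσ i
  simp only [Fin.cast_eq_self]
  rw [h]
  push_cast
  exact Int.mod_modEq _ _
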